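/- Let X be a path-connected metric space with basepoint x, let δ > 0, R > 0, and r > 3(R + 2δ), and give the open ball B(x,r) ⊆ X the restricted metric. If δ ∈ CovSpec^R_cut(B(x,r), x), then δ ∈ CovSpec^R_cut(X, x). -/

import Mathlib

/- Common definitions: path length, length/geodesic spaces, δ-covering groups,
   covering spectra, cut-off covering groups and spectra, free homotopy,
   loops-to-infinity. -/

open Metric Filter
open scoped NNReal ENNReal unitInterval

attribute [local instance] Path.Homotopic.setoid

/-- The length (total variation) of a path in a metric space. -/
noncomputable def pathLength {X : Type*} [MetricSpace X] {x y : X} (γ : Path x y) : ℝ≥0∞ :=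
  eVariationOn γ Set.univ

/-- A metric space is a length space if the distance between any two points is the
infimum of the lengths of paths joining them. -/
def IsLengthSpace (X : Type*) [MetricSpace X] : Prop :=
  ∀ x y : X, ENNReal.ofReal (dist x y) = ⨅ γ : Path x y, pathLength γ

/-- A metric space is a geodesic space if any two points are joined by a
distance-realizing path. -/
def IsGeodesicSpace (X : Type*) [MetricSpace X] : Prop :=
  ∀ x y : X, ∃ γ : Path x y, pathLength γ = ENNReal.ofReal (dist x y)

/-- The element of the fundamental group at `p` represented by the loop
`α⁻¹ · β · α` (i.e. follow `α` from `p` to `y`, the loop `β` at `y`, then `α` back). -/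
noncomputable def loopClass {X : Type*} [TopologicalSpace X] {p y : X}
    (α : Path p y) (β : Path y y) : FundamentalGroup X p :=
  FundamentalGroup.fromPath (X := TopCat.of X) ⟦(α.trans β).trans α.symm⟧

/-- The δ-covering group `π₁(X, δ, p)`: the normal subgroup of `π₁(X,p)` generated by
classes of loops `α⁻¹·β·α` with `β` lying in some open ball of radius `δ`. -/
noncomputable def coveringGroup (X : Type*) [MetricSpace X] (p : X) (δ : ℝ) :
    Subgroup (FundamentalGroup X p) :=
  Subgroup.normalClosure
    {g | ∃ (y : X) (β : Path y y) (α : Path p y),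
      (∃ c : X, ∀ t, β t ∈ Metric.ball c δ) ∧ g = loopClass α β}

/-- The covering spectrum of `X` (with basepoint `p`). -/
def covSpec (X : Type*) [MetricSpace X] (p : X) : Set ℝ :=
  {δ | 0 < δ ∧ ∀ δ' > δ, coveringGroup X p δ' ≠ coveringGroup X p δ}

/-- The `R` cut-off δ-covering group `π₁^{cut}(X, δ, R, x)`: the normal subgroup of
`π₁(X,x)` generated by classes of loops `α⁻¹·β·α` with `β` lying in some open ball of
radius `δ` or in the complement of the closed ball `B̄(x,R)`. -/
noncomputable def cutCoveringGroup (X : Type*) [MetricSpace X] (x : X) (δ R : ℝ) :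
    Subgroup (FundamentalGroup X x) :=
  Subgroup.normalClosure
    {g | ∃ (y : X) (β : Path y y) (α : Path x y),
      ((∃ c : X, ∀ t, β t ∈ Metric.ball c δ) ∨ (∀ t, β t ∉ Metric.closedBall x R)) ∧
      g = loopClass α β}

/-- The `R` cut-off covering spectrum of `(X,x)`. -/
def cutCovSpec (X : Type*) [MetricSpace X] (x : X) (R : ℝ) : Set ℝ :=
  {δ | 0 < δ ∧ ∀ δ' > δ, cutCoveringGroup X x δ' R ≠ cutCoveringGroup X x δ R}

/-- Two loops are freely homotopic: there is a homotopy through (not necessarily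
based) loops from one to the other. -/
def FreelyHomotopic {X : Type*} [TopologicalSpace X] {a b : X}
    (γ₀ : Path a a) (γ₁ : Path b b) : Prop :=
  ∃ H : C(I × I, X),
    (∀ t, H (0, t) = γ₀ t) ∧ (∀ t, H (1, t) = γ₁ t) ∧ ∀ s, H (s, 0) = H (s, 1)

/-- Two loops are freely homotopic within a subset `A`: the homotopy stays in `A`. -/
def FreelyHomotopicIn {X : Type*} [TopologicalSpace X] (A : Set X) {a b : X}
    (γ₀ : Path a a) (γ₁ : Path b b) : Prop :=
  ∃ H : C(I × I, X),
    (∀ t, H (0, t) = γ₀ t) ∧ (∀ t, H (1, t) = γ₁ t) ∧ (∀ s, H (s, 0) = H (s, 1)) ∧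
    ∀ p, H p ∈ A

/-- A loop has the loops-to-infinity property: for every compact set it is freely
homotopic to a loop outside that set. -/
def LoopToInfinity {X : Type*} [TopologicalSpace X] {a : X} (γ : Path a a) : Prop :=
  ∀ K : Set X, IsCompact K →
    ∃ (b : X) (η : Path b b), (∀ t, η t ∉ K) ∧ FreelyHomotopic γ η

/-- A space has the loops-to-infinity property if all of its loops do. -/
def LoopsToInfinity (X : Type*) [TopologicalSpace X] : Prop :=
  ∀ (a : X) (γ : Path a a), LoopToInfinity γ

/-- Concatenation of a finite list of loops based at `q`. -/
noncomputable def loopConcat {X : Type*} [TopologicalSpace X] (q : X) :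
    List (Path q q) → Path q q
  | [] => Path.refl q
  | γ :: rest => γ.trans (loopConcat q rest)

/-- A space is semilocally simply connected if every point has a neighborhood in which
every loop is null-homotopic in the whole space. -/
def SemilocallySimplyConnected (X : Type*) [TopologicalSpace X] : Prop :=
  ∀ x : X, ∃ U ∈ nhds x, ∀ (y : X) (γ : Path y y), (∀ t, γ t ∈ U) →
    γ.Homotopic (Path.refl y)

/-- A pointed ε-Hausdorff approximation. -/
def IsPointedHausdorffApprox {Z₁ Z₂ : Type*} [MetricSpace Z₁] [MetricSpace Z₂]
    (f : Z₁ → Z₂) (p₁ : Z₁) (p₂ : Z₂) (ε : ℝ) : Prop :=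
  f p₁ = p₂ ∧ (∀ a b : Z₁, |dist (f a) (f b) - dist a b| < ε) ∧
    ∀ z : Z₂, ∃ a : Z₁, dist z (f a) ≤ ε

instance coveringGroup_normal (X : Type*) [MetricSpace X] (p : X) (δ : ℝ) :
    (coveringGroup X p δ).Normal :=
  Subgroup.normalClosure_normal

instance cutCoveringGroup_normal (X : Type*) [MetricSpace X] (x : X) (δ R : ℝ) :
    (cutCoveringGroup X x δ R).Normal :=
  Subgroup.normalClosure_normal

namespace CutAux

section Abs
variable {X : Type*} [TopologicalSpace X] {G : Type*} [Group G]

/-- image of a straight segment -/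
def seg (f : C(ℝ × ℝ, X)) (a b : ℝ × ℝ) : C(I, X) :=
  ⟨fun t => f (a + (t : ℝ) • (b - a)), by fun_prop⟩

def seg1 (f : C(ℝ, X)) (a b : ℝ) : C(I, X) :=
  ⟨fun t => f (a + (t : ℝ) * (b - a)), by fun_prop⟩

def Coc (φ : C(I, X) → G) (U V : Set X) : Prop :=
  ∀ (f : C(ℝ × ℝ, X)) (K : Set (ℝ × ℝ)), Convex ℝ K →
    ((∀ z ∈ K, f z ∈ U) ∨ (∀ z ∈ K, f z ∈ V)) → ∀ a ∈ K, ∀ b ∈ K, ∀ d ∈ K,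
    φ (seg f a d) = φ (seg f b d) * φ (seg f a b)

variable {φ : C(I, X) → G} {U V : Set X}

lemma Coc.one (h : Coc φ U V) (hUV : ∀ x, x ∈ U ∨ x ∈ V) (f : C(ℝ × ℝ, X)) (a : ℝ × ℝ) :
    φ (seg f a a) = 1 := by
  have := h f {a} (convex_singleton a) (by simpa using hUV (f a)) a rfl a rfl a rfl
  simpa using this

lemma seg1_eq (f : C(ℝ, X)) (a b c : ℝ) :
    seg1 f a b = seg (f.comp ⟨Prod.snd, continuous_snd⟩) (c, a) (c, b) := by
  ext t; simp [seg1, seg]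

lemma Coc.tri1 (h : Coc φ U V) (f : C(ℝ, X)) (u v : ℝ)
    (hK : (∀ z ∈ Set.Icc u v, f z ∈ U) ∨ (∀ z ∈ Set.Icc u v, f z ∈ V))
    {a b d : ℝ} (ha : a ∈ Set.Icc u v) (hb : b ∈ Set.Icc u v) (hd : d ∈ Set.Icc u v) :
    φ (seg1 f a d) = φ (seg1 f b d) * φ (seg1 f a b) := by
  rw [seg1_eq f a d 0, seg1_eq f b d 0, seg1_eq f a b 0]
  refine h _ (Set.univ ×ˢ Set.Icc u v) (convex_univ.prod (convex_Icc u v)) ?_ _ ⟨trivial, ha⟩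
    _ ⟨trivial, hb⟩ _ ⟨trivial, hd⟩
  rcases hK with hK | hK
  · exact Or.inl fun z hz => hK _ hz.2
  · exact Or.inr fun z hz => hK _ hz.2

lemma Coc.one1 (h : Coc φ U V) (hUV : ∀ x, x ∈ U ∨ x ∈ V) (f : C(ℝ, X)) (a : ℝ) :
    φ (seg1 f a a) = 1 := by
  rw [seg1_eq f a a 0]; exact h.one hUV _ _

noncomputable def P (φ : C(I, X) → G) (f : C(ℝ, X)) (n : ℕ) : ℕ → G
  | 0 => 1
  | k + 1 => φ (seg1 f ((k : ℝ) / n) (((k : ℝ) + 1) / n)) * P φ f n k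

def Good (U V : Set X) (f : C(ℝ, X)) (n : ℕ) : Prop :=
  0 < n ∧ ∀ k < n, (∀ t ∈ Set.Icc ((k : ℝ) / n) (((k : ℝ) + 1) / n), f t ∈ U) ∨
    (∀ t ∈ Set.Icc ((k : ℝ) / n) (((k : ℝ) + 1) / n), f t ∈ V)

lemma P_refine_aux (h : Coc φ U V) (hUV : ∀ x, x ∈ U ∨ x ∈ V) {f : C(ℝ, X)} {n m : ℕ}
    (hm : 0 < m) (hg : Good U V f n) (k : ℕ) (hk : k < n) (j : ℕ) (hj : j ≤ m) :
    P φ f (n * m) (k * m + j) =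
      φ (seg1 f ((k : ℝ) / n) (((k : ℝ) * m + j) / (n * m))) * P φ f (n * m) (k * m) := by
  have hn : (0 : ℝ) < n := by exact_mod_cast hg.1
  have hm' : (0 : ℝ) < m := by exact_mod_cast hm
  induction j with
  | zero =>
    have : ((k : ℝ) * m + (0 : ℕ)) / (n * m) = k / n := by
      field_simp; simp
    rw [this, h.one1 hUV]; simp
  | succ j ih =>
    have ih := ih (by omega)
    have hj' : (j : ℝ) + 1 ≤ m := by exact_mod_cast hj
    have hj0 : (0 : ℝ) ≤ j := by positivity
    have e1 : (((k * m + j : ℕ) : ℝ)) / ((n * m : ℕ) : ℝ) = ((k : ℝ) * m + j) / (n * m) := by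
      push_cast; ring
    have e2 : (((k * m + j : ℕ) : ℝ) + 1) / ((n * m : ℕ) : ℝ)
        = ((k : ℝ) * m + ((j + 1 : ℕ) : ℝ)) / (n * m) := by
      push_cast; ring
    have bd : ∀ s : ℝ, 0 ≤ s → s ≤ m →
        ((k : ℝ) * m + s) / (n * m) ∈ Set.Icc ((k : ℝ) / n) (((k : ℝ) + 1) / n) := by
      intro s h0 h1
      constructor
      · rw [div_le_div_iff₀ hn (by positivity)]; nlinarith [mul_nonneg hn.le h0]
      · rw [div_le_div_iff₀ (by positivity) hn]; nlinarith [mul_le_mul_of_nonneg_left h1 hn.le]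
    rw [← add_assoc, P, ih, e1, e2, ← mul_assoc]
    congr 1
    refine (h.tri1 f _ _ (hg.2 k hk) ?_ ?_ ?_).symm
    · exact ⟨le_rfl, by gcongr; linarith⟩
    · exact bd j hj0 (by linarith)
    · exact bd _ (by positivity) (by push_cast; linarith)

lemma P_refine (h : Coc φ U V) (hUV : ∀ x, x ∈ U ∨ x ∈ V) {f : C(ℝ, X)} {n m : ℕ}
    (hm : 0 < m) (hg : Good U V f n) (k : ℕ) (hk : k ≤ n) :
    P φ f (n * m) (k * m) = P φ f n k := by
  have hn : (0 : ℝ) < n := by exact_mod_cast hg.1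
  have hm' : (0 : ℝ) < m := by exact_mod_cast hm
  induction k with
  | zero => simp [P]
  | succ k ih =>
    have := P_refine_aux h hUV hm hg k (by omega) m le_rfl
    rw [add_mul, one_mul, this, ih (by omega), P]
    congr 3
    field_simp

lemma P_eq (h : Coc φ U V) (hUV : ∀ x, x ∈ U ∨ x ∈ V) {f : C(ℝ, X)} {n m : ℕ}
    (hn : Good U V f n) (hm : Good U V f m) : P φ f n n = P φ f m m := by
  rw [← P_refine h hUV hm.1 hn n le_rfl, ← P_refine h hUV hn.1 hm m le_rfl, mul_comm n m]

lemma Good.mul {f : C(ℝ, X)} {n m : ℕ} (hn : Good U V f n) (hm : 0 < m) :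
    Good U V f (n * m) := by
  refine ⟨Nat.mul_pos hn.1 hm, fun k hk => ?_⟩
  have hn' : (0 : ℝ) < n := by exact_mod_cast hn.1
  have hm' : (0 : ℝ) < m := by exact_mod_cast hm
  have hlt : k / m < n := by
    rw [Nat.div_lt_iff_lt_mul hm]; exact hk
  have h1 : ((k / m : ℕ) : ℝ) * m ≤ k := by exact_mod_cast Nat.div_mul_le_self k m
  have h2 : (k : ℝ) + 1 ≤ (((k / m : ℕ) : ℝ) + 1) * m := by
    have := Nat.lt_div_mul_add (a := k) hm
    have : k + 1 ≤ (k / m + 1) * m := by rw [add_mul]; omega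
    exact_mod_cast this
  have sub : Set.Icc ((k : ℝ) / ((n * m : ℕ) : ℝ)) (((k : ℝ) + 1) / ((n * m : ℕ) : ℝ)) ⊆
      Set.Icc (((k / m : ℕ) : ℝ) / n) ((((k / m : ℕ) : ℝ) + 1) / n) := by
    push_cast
    apply Set.Icc_subset_Icc
    · rw [div_le_div_iff₀ hn' (by positivity)]; nlinarith
    · rw [div_le_div_iff₀ (by positivity) hn']; nlinarith
  rcases hn.2 _ hlt with h | h
  · exact Or.inl fun t ht => h t (sub ht)
  · exact Or.inr fun t ht => h t (sub ht)

def Good2 (U V : Set X) (H : C(ℝ × ℝ, X)) (n : ℕ) : Prop :=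
  0 < n ∧ ∀ i < n, ∀ k < n,
    (∀ z ∈ Set.Icc ((i : ℝ) / n) (((i : ℝ) + 1) / n) ×ˢ Set.Icc ((k : ℝ) / n) (((k : ℝ) + 1) / n),
      H z ∈ U) ∨
    (∀ z ∈ Set.Icc ((i : ℝ) / n) (((i : ℝ) + 1) / n) ×ˢ Set.Icc ((k : ℝ) / n) (((k : ℝ) + 1) / n),
      H z ∈ V)

lemma exists_good2 (hU : IsOpen U) (hV : IsOpen V) (hUV : ∀ x, x ∈ U ∨ x ∈ V)
    (H : C(ℝ × ℝ, X)) : ∃ n, Good2 U V H n := by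
  obtain ⟨ε, hε, hL⟩ := lebesgue_number_lemma_of_metric
    (s := Set.Icc (0 : ℝ) 1 ×ˢ Set.Icc (0 : ℝ) 1) (ι := Bool)
    (c := fun b => H ⁻¹' (if b then U else V)) (isCompact_Icc.prod isCompact_Icc)
    (by intro b; cases b <;> simp [hU.preimage H.continuous, hV.preimage H.continuous])
    (by
      intro z _
      rcases hUV (H z) with h | h
      · exact Set.mem_iUnion.2 ⟨true, by simpa using h⟩
      · exact Set.mem_iUnion.2 ⟨false, by simpa using h⟩)
  obtain ⟨n, hn⟩ := exists_nat_one_div_lt hε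
  refine ⟨n + 1, Nat.succ_pos _, fun i hi k hk => ?_⟩
  have hn0 : (0 : ℝ) < ((n + 1 : ℕ) : ℝ) := by positivity
  have hn : 1 / ((n + 1 : ℕ) : ℝ) < ε := by simpa using hn
  have mem : ∀ j : ℕ, j < n + 1 → (j : ℝ) / ((n + 1 : ℕ) : ℝ) ∈ Set.Icc (0 : ℝ) 1 := by
    intro j hj
    refine ⟨by positivity, ?_⟩
    rw [div_le_one hn0]; exact_mod_cast hj.le
  have d : ∀ (j : ℕ) (t : ℝ), t ∈ Set.Icc ((j : ℝ) / ((n + 1 : ℕ) : ℝ)) (((j : ℝ) + 1) / ((n + 1 : ℕ) : ℝ)) →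
      dist t ((j : ℝ) / ((n + 1 : ℕ) : ℝ)) < ε := by
    intro j t ht
    rw [Real.dist_eq, abs_of_nonneg (by linarith [ht.1])]
    have := ht.2
    rw [add_div] at this
    linarith
  obtain ⟨b, hb⟩ := hL ((i : ℝ) / ((n + 1 : ℕ) : ℝ), (k : ℝ) / ((n + 1 : ℕ) : ℝ)) ⟨mem i hi, mem k hk⟩
  cases b
  · right
    intro z hz
    have := hb (show z ∈ Metric.ball _ ε from max_lt (d i _ hz.1) (d k _ hz.2))
    simpa using this
  · left
    intro z hz
    have := hb (show z ∈ Metric.ball _ ε from max_lt (d i _ hz.1) (d k _ hz.2))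
    simpa using this

def row (H : C(ℝ × ℝ, X)) (s : ℝ) : C(ℝ, X) := ⟨fun t => H (s, t), by fun_prop⟩

lemma Good2.row {H : C(ℝ × ℝ, X)} {n : ℕ} (h : Good2 U V H n) (i : ℕ) (hi : i < n) (s : ℝ)
    (hs : s ∈ Set.Icc ((i : ℝ) / n) (((i : ℝ) + 1) / n)) : Good U V (row H s) n := by
  refine ⟨h.1, fun k hk => ?_⟩
  rcases h.2 i hi k hk with h | h
  · exact Or.inl fun t ht => h (s, t) ⟨hs, ht⟩
  · exact Or.inr fun t ht => h (s, t) ⟨hs, ht⟩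

lemma exists_good (hU : IsOpen U) (hV : IsOpen V) (hUV : ∀ x, x ∈ U ∨ x ∈ V)
    (f : C(ℝ, X)) : ∃ n, Good U V f n := by
  obtain ⟨n, hn⟩ := exists_good2 hU hV hUV (f.comp ⟨Prod.snd, continuous_snd⟩)
  exact ⟨n, hn.row 0 hn.1 0 ⟨by simp, by positivity⟩⟩

lemma row_step (h : Coc φ U V) (hUV : ∀ x, x ∈ U ∨ x ∈ V) {H : C(ℝ × ℝ, X)} {n : ℕ}
    (hg : Good2 U V H n) (H0 : ∀ s s', H (s, 0) = H (s', 0))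
    (i : ℕ) (hi : i < n) (k : ℕ) (hk : k ≤ n) :
    φ (seg H ((i : ℝ) / n, (k : ℝ) / n) (((i : ℝ) + 1) / n, (k : ℝ) / n)) *
      P φ (row H ((i : ℝ) / n)) n k = P φ (row H (((i : ℝ) + 1) / n)) n k := by
  have hn : (0 : ℝ) < n := by exact_mod_cast hg.1
  induction k with
  | zero =>
    have : seg H ((i : ℝ) / n, ((0 : ℕ) : ℝ) / n) (((i : ℝ) + 1) / n, ((0 : ℕ) : ℝ) / n)
        = seg H (0, 0) (0, 0) := by
      ext t; simp [seg]; apply H0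
    rw [this, h.one hUV]; simp [P]
  | succ k ih =>
    have ih := ih (by omega)
    have r : ∀ s a b, seg1 (row H s) a b = seg H (s, a) (s, b) := by
      intro s a b; ext t; simp [seg1, seg, row]
    have I1 : (i : ℝ) / n ≤ ((i : ℝ) + 1) / n := by gcongr; linarith
    have K1 : (k : ℝ) / n ≤ ((k : ℝ) + 1) / n := by gcongr; linarith
    have T := h H _ ((convex_Icc ((i : ℝ) / n) (((i : ℝ) + 1) / n)).prod
      (convex_Icc ((k : ℝ) / n) (((k : ℝ) + 1) / n))) (hg.2 i hi k (by omega))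
    rw [P, P, ← ih, r, r, ← mul_assoc, ← mul_assoc]
    congr 1
    push_cast
    rw [← T _ ⟨⟨le_rfl, I1⟩, ⟨le_rfl, K1⟩⟩ _ ⟨⟨le_rfl, I1⟩, ⟨K1, le_rfl⟩⟩ _ ⟨⟨I1, le_rfl⟩, ⟨K1, le_rfl⟩⟩,
      ← T _ ⟨⟨le_rfl, I1⟩, ⟨le_rfl, K1⟩⟩ _ ⟨⟨I1, le_rfl⟩, ⟨le_rfl, K1⟩⟩ _ ⟨⟨I1, le_rfl⟩, ⟨K1, le_rfl⟩⟩]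

lemma row_all (h : Coc φ U V) (hUV : ∀ x, x ∈ U ∨ x ∈ V) {H : C(ℝ × ℝ, X)} {n : ℕ}
    (hg : Good2 U V H n) (H0 : ∀ s s', H (s, 0) = H (s', 0)) (H1 : ∀ s s', H (s, 1) = H (s', 1))
    (i : ℕ) (hi : i ≤ n) :
    P φ (row H ((i : ℝ) / n)) n n = P φ (row H 0) n n := by
  have hn : (n : ℝ) ≠ 0 := by exact_mod_cast hg.1.ne'
  induction i with
  | zero => simp
  | succ i ih =>
    rw [← ih (by omega)]
    have := row_step h hUV hg H0 i (by omega) n le_rfl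
    have e : seg H ((i : ℝ) / n, (n : ℝ) / n) (((i : ℝ) + 1) / n, (n : ℝ) / n)
        = seg H (0, 1) (0, 1) := by
      ext t; simp [seg, div_self hn]; apply H1
    rw [e, h.one hUV, one_mul] at this
    push_cast
    exact this.symm

noncomputable def ext {a b : X} (p : Path a b) : C(ℝ, X) := ⟨p.extend, p.continuous_extend⟩

open Classical in
noncomputable def Phi (φ : C(I, X) → G) (U V : Set X) {a b : X} (p : Path a b) : G :=
  if h : ∃ n, Good U V (ext p) n then P φ (ext p) h.choose h.choose else 1

lemma Phi_eq (h : Coc φ U V) (hUV : ∀ x, x ∈ U ∨ x ∈ V) {a b : X} (p : Path a b) {n : ℕ}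
    (hn : Good U V (ext p) n) : Phi φ U V p = P φ (ext p) n n := by
  have hex : ∃ n, Good U V (ext p) n := ⟨n, hn⟩
  rw [Phi, dif_pos hex]
  exact P_eq h hUV hex.choose_spec hn

lemma Phi_homotopic (h : Coc φ U V) (hU : IsOpen U) (hV : IsOpen V)
    (hUV : ∀ x, x ∈ U ∨ x ∈ V) {a b : X} {p q : Path a b}
    (hpq : p.Homotopic q) : Phi φ U V p = Phi φ U V q := by
  obtain ⟨F⟩ := hpq
  let H : C(ℝ × ℝ, X) := ⟨fun z => F (Set.projIcc 0 1 zero_le_one z.1, Set.projIcc 0 1 zero_le_one z.2),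
    by
      have := continuous_projIcc (a := (0 : ℝ)) (b := 1) (h := zero_le_one)
      fun_prop⟩
  obtain ⟨n, hn⟩ := exists_good2 hU hV hUV H
  have hn0 : (n : ℝ) ≠ 0 := by exact_mod_cast hn.1.ne'
  have hn1 : (0 : ℝ) < n := by exact_mod_cast hn.1
  have r0 : row H 0 = ext p := by
    ext t
    simp [row, H, ext, Path.extend, Set.IccExtend]
  have r1 : row H 1 = ext q := by
    ext t
    simp [row, H, ext, Path.extend, Set.IccExtend]
  have g0 : Good U V (ext p) n := r0 ▸ hn.row 0 hn.1 0 ⟨by simp, by positivity⟩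
  have g1 : Good U V (ext q) n := by
    rw [← r1]
    refine hn.row (n - 1) (Nat.sub_lt hn.1 one_pos) 1 ⟨?_, ?_⟩
    · rw [div_le_one hn1]; exact_mod_cast Nat.sub_le _ _
    · rw [Nat.cast_pred hn.1, le_div_iff₀ hn1]; simp
  rw [Phi_eq h hUV p g0, Phi_eq h hUV q g1, ← r0, ← r1]
  have := row_all h hUV hn (by intro s s'; simp [H]) (by intro s s'; simp [H]) n le_rfl
  rw [div_self hn0] at this
  exact this.symm

lemma ext_trans_left {a b c : X} (p : Path a b) (q : Path b c) {t : ℝ} (ht0 : 0 ≤ t) (ht : t ≤ 1 / 2) :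
    ext (p.trans q) t = ext p (2 * t) := by
  have : t ∈ Set.Icc (0 : ℝ) 1 := ⟨ht0, by linarith⟩
  change (p.trans q).extend t = p.extend (2 * t)
  rw [Path.extend_apply _ this, Path.trans_apply, dif_pos ht]
  rw [Path.extend_apply]

lemma ext_trans_right {a b c : X} (p : Path a b) (q : Path b c) {t : ℝ} (ht0 : 1 / 2 ≤ t) (ht : t ≤ 1) :
    ext (p.trans q) t = ext q (2 * t - 1) := by
  rcases ht0.eq_or_lt with rfl | h
  · rw [ext_trans_left p q (by norm_num) le_rfl]
    change p.extend _ = q.extend _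
    norm_num
  have : t ∈ Set.Icc (0 : ℝ) 1 := ⟨by linarith, by linarith⟩
  change (p.trans q).extend t = q.extend (2 * t - 1)
  rw [Path.extend_apply _ this, Path.trans_apply, dif_neg (by simpa using h)]
  rw [Path.extend_apply]

lemma Phi_trans (h : Coc φ U V) (hU : IsOpen U) (hV : IsOpen V)
    (hUV : ∀ x, x ∈ U ∨ x ∈ V) {a b c : X} (p : Path a b) (q : Path b c) :
    Phi φ U V (p.trans q) = Phi φ U V q * Phi φ U V p := by
  obtain ⟨n₁, hn₁⟩ := exists_good hU hV hUV (ext p)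
  obtain ⟨n₂, hn₂⟩ := exists_good hU hV hUV (ext q)
  obtain ⟨n₃, hn₃⟩ := exists_good hU hV hUV (ext (p.trans q))
  set n := n₁ * (n₂ * n₃) with hn
  have gp : Good U V (ext p) n := hn₁.mul (Nat.mul_pos hn₂.1 hn₃.1)
  have gq : Good U V (ext q) n := by
    have := hn₂.mul (Nat.mul_pos hn₁.1 hn₃.1)
    rwa [show n = n₂ * (n₁ * n₃) by rw [hn]; ring]
  have gpq : Good U V (ext (p.trans q)) (n + n) := by
    have := hn₃.mul (m := 2 * n₁ * n₂) (by have := hn₁.1; have := hn₂.1; positivity)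
    rwa [show n + n = n₃ * (2 * n₁ * n₂) by rw [hn]; ring]
  have hn1 : (0 : ℝ) < n := by exact_mod_cast gp.1
  rw [Phi_eq h hUV p gp, Phi_eq h hUV q gq, Phi_eq h hUV _ gpq]
  have s1 : ∀ k ≤ n, P φ (ext (p.trans q)) (n + n) k = P φ (ext p) n k := by
    intro k hk
    induction k with
    | zero => rfl
    | succ k ih =>
      rw [P, P, ih (by omega)]
      congr 2
      ext t
      have ht0 := t.2.1
      have ht1 := t.2.2
      have hk' : (k : ℝ) + 1 ≤ n := by exact_mod_cast hk
      have hk0 : (0 : ℝ) ≤ k := by positivity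
      have e : (k : ℝ) / ((n + n : ℕ) : ℝ) + (t : ℝ) * (((k : ℝ) + 1) / ((n + n : ℕ) : ℝ) - (k : ℝ) / ((n + n : ℕ) : ℝ))
          = (k + t) / (n + n) := by push_cast; field_simp; ring
      change ext (p.trans q) _ = ext p _
      rw [e, ext_trans_left]
      · congr 1; field_simp; ring
      · positivity
      · rw [div_le_div_iff₀ (by positivity) (by norm_num)]; linarith
  have s2 : ∀ k ≤ n, P φ (ext (p.trans q)) (n + n) (n + k) = P φ (ext q) n k * P φ (ext p) n n := by
    intro k hk
    induction k with
    | zero => simp [P, s1]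
    | succ k ih =>
      rw [← add_assoc, P, P, ih (by omega), mul_assoc]
      congr 2
      ext t
      have ht0 := t.2.1
      have ht1 := t.2.2
      have hk' : (k : ℝ) + 1 ≤ n := by exact_mod_cast hk
      have hk0 : (0 : ℝ) ≤ k := by positivity
      have e : ((n + k : ℕ) : ℝ) / ((n + n : ℕ) : ℝ) + (t : ℝ) * ((((n + k : ℕ) : ℝ) + 1) / ((n + n : ℕ) : ℝ) - ((n + k : ℕ) : ℝ) / ((n + n : ℕ) : ℝ))
          = (n + k + t) / (n + n) := by push_cast; field_simp; ring
      change ext (p.trans q) _ = ext q _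
      rw [e, ext_trans_right]
      · congr 1; field_simp; ring
      · rw [div_le_div_iff₀ (by norm_num) (by positivity)]; linarith
      · rw [div_le_one (by positivity)]; linarith
  exact s2 n le_rfl

lemma Phi_of_mem (h : Coc φ U V) (hUV : ∀ x, x ∈ U ∨ x ∈ V) {a b : X} (p : Path a b)
    (hp : (∀ t, p t ∈ U) ∨ (∀ t, p t ∈ V)) : Phi φ U V p = φ p.toContinuousMap := by
  have g : Good U V (ext p) 1 := by
    refine ⟨one_pos, fun k hk => ?_⟩
    rcases hp with hp | hp
    · exact Or.inl fun t _ => hp _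
    · exact Or.inr fun t _ => hp _
  rw [Phi_eq h hUV p g]
  simp only [P, mul_one]
  congr 1
  ext t
  simp [seg1, ext]

lemma Phi_refl (h : Coc φ U V) (hUV : ∀ x, x ∈ U ∨ x ∈ V) (a : X) :
    Phi φ U V (Path.refl a) = 1 := by
  rw [Phi_of_mem h hUV _ (by simpa using hUV a)]
  rw [← h.one hUV (ContinuousMap.const _ a) 0]
  congr 1

end Abs

section Con
open CategoryTheory

variable {Y : Type*} [TopologicalSpace Y]

/-- The class of a path, as an arrow. -/
def qq {a b : Y} (p : Path a b) : FundamentalGroupoid.mk a ⟶ FundamentalGroupoid.mk b :=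
  Path.Homotopic.Quotient.mk p

lemma qq_trans {a b c : Y} (p : Path a b) (q : Path b c) : qq (p.trans q) = qq p ≫ qq q := rfl

lemma qq_symm {a b : Y} (p : Path a b) : qq p.symm = Groupoid.inv (qq p) := rfl

lemma qq_eq {a b : Y} {p q : Path a b} (h : p.Homotopic q) : qq p = qq q :=
  Path.Homotopic.Quotient.eq.2 h

lemma loopClass_eq {p y : Y} (α : Path p y) (β : Path y y) :
    loopClass α β = qq α ≫ qq β ≫ Groupoid.inv (qq α) := by
  rw [← Category.assoc]; rfl

lemma exists_tau (x0 : Y) (A : Set Y) (N : Subgroup (FundamentalGroup Y x0))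
    (hA : ∀ (y : Y) (β : Path y y) (α : Path x0 y), (∀ t, β t ∈ A) → loopClass α β ∈ N) :
    ∃ τ : ∀ a : Y, Joined x0 a → Path x0 a, ∀ (a b : Y) (ha : Joined x0 a) (hb : Joined x0 b)
      (p : Path a b), (∀ t, p t ∈ A) →
      (qq (τ a ha) ≫ qq p ≫ Groupoid.inv (qq (τ b hb)) : FundamentalGroup Y x0) ∈ N := by
  classical
  let rep : A → A := fun a => (Quotient.mk (pathSetoid A) a).out
  have hrep : ∀ a, Joined (rep a) a := fun a => Quotient.mk_out (s := pathSetoid A) a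
  have hrep2 : ∀ a b, Joined a b → rep a = rep b := fun a b h =>
    congrArg Quotient.out (Quotient.sound (s := pathSetoid A) h)
  let sg : ∀ a : A, Path (rep a : Y) (a : Y) := fun a => (hrep a).somePath.map continuous_subtype_val
  have hσ : ∀ a t, sg a t ∈ A := fun a t => ((hrep a).somePath t).2
  let π : ∀ w : Y, Joined x0 w → Path x0 w := fun w h => h.somePath
  have hj : ∀ (a : A), Joined x0 (a : Y) → Joined x0 (rep a : Y) := fun a h =>
    h.trans ⟨(sg a).symm⟩
  refine ⟨fun a h => if hA : a ∈ A then (π _ (hj ⟨a, hA⟩ h)).trans (sg ⟨a, hA⟩) else π a h, ?_⟩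
  intro a b ha hb p hp
  have haA : a ∈ A := by simpa using hp 0
  have hbA : b ∈ A := by simpa using hp 1
  have hab : Joined (⟨a, haA⟩ : A) ⟨b, hbA⟩ :=
    ⟨⟨⟨fun t => ⟨p t, hp t⟩, by fun_prop⟩, by simp, by simp⟩⟩
  have key : ∀ (w w' : Y) (e : w = w') (hw : Joined x0 w) (hw' : Joined x0 w') (s : Path w a)
      (s' : Path w' b), (∀ t, s t ∈ A) → (∀ t, s' t ∈ A) →
      (qq ((π w hw).trans s) ≫ qq p ≫ Groupoid.inv (qq ((π w' hw').trans s')) :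
        FundamentalGroup Y x0) ∈ N := by
    intro w w' e hw hw' s s' hs hs'
    subst e
    have := hA w ((s.trans p).trans s'.symm) (π w hw) (by
      intro t
      have : ((s.trans p).trans s'.symm) t ∈ Set.range ((s.trans p).trans s'.symm) := ⟨t, rfl⟩
      rw [Path.trans_range, Path.trans_range, Path.symm_range] at this
      rcases this with (⟨u, hu⟩ | ⟨u, hu⟩) | ⟨u, hu⟩
      · rw [← hu]; exact hs u
      · rw [← hu]; exact hp u
      · rw [← hu]; exact hs' u)
    rw [loopClass_eq] at this
    simpa [qq_trans, qq_symm, Groupoid.inv_eq_inv] using this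
  simp only [dif_pos haA, dif_pos hbA]
  exact key _ _ (congrArg Subtype.val (hrep2 _ _ hab)) _ _ _ _ (hσ _) (hσ _)

lemma exists_F (x0 : Y) (A : Set Y) (N : Subgroup (FundamentalGroup Y x0)) [N.Normal]
    (hA : ∀ (y : Y) (β : Path y y) (α : Path x0 y), (∀ t, β t ∈ A) → loopClass α β ∈ N) :
    ∃ F : ∀ {a b : Y}, Path a b → FundamentalGroup Y x0 ⧸ N,
      (∀ {a b : Y} {p q : Path a b}, p.Homotopic q → F p = F q) ∧
      (∀ {a b c : Y} (p : Path a b) (q : Path b c), F (p.trans q) = F q * F p) ∧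
      (∀ {a b : Y} (p : Path a b), (∀ t, p t ∈ A) → F p = 1) ∧
      (∀ γ : Path x0 x0, F γ = 1 → (qq γ : FundamentalGroup Y x0) ∈ N) ∧
      (∀ {y : Y} (β : Path y y), (∀ α : Path x0 y, loopClass α β ∈ N) → F β = 1) := by
  classical
  obtain ⟨τ, hτ⟩ := exists_tau x0 A N hA
  let F : ∀ {a b : Y}, Path a b → FundamentalGroup Y x0 ⧸ N := fun {a b} p =>
    if h : Joined x0 a then
      QuotientGroup.mk (qq (τ a h) ≫ qq p ≫ Groupoid.inv (qq (τ b (h.trans ⟨p⟩))) :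
        FundamentalGroup Y x0) else 1
  refine ⟨F, ?_, ?_, ?_, ?_, ?_⟩
  · intro a b p q h
    simp only [F, qq_eq h]
  · intro a b c p q
    by_cases h : Joined x0 a
    · have hb : Joined x0 b := h.trans ⟨p⟩
      simp only [F, dif_pos h, dif_pos hb]
      rw [← QuotientGroup.mk_mul, End.mul_def]
      simp [qq_trans, Groupoid.inv_eq_inv]
    · have hb : ¬ Joined x0 b := fun hb => h (hb.trans ⟨p.symm⟩)
      simp only [F, dif_neg h, dif_neg hb, mul_one]
  · intro a b p hp
    by_cases h : Joined x0 a
    · simp only [F, dif_pos h]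
      exact (QuotientGroup.eq_one_iff _).2 (hτ _ _ _ _ p hp)
    · simp only [F, dif_neg h]
  · intro γ hγ
    have h : Joined x0 x0 := Joined.refl _
    simp only [F, dif_pos h] at hγ
    have hm := (QuotientGroup.eq_one_iff _).1 hγ
    let T : FundamentalGroup Y x0 := qq (τ x0 h)
    let g : FundamentalGroup Y x0 := qq γ
    have hm' : T⁻¹ * g * T ∈ N := hm
    have := (inferInstance : N.Normal).conj_mem _ hm' T
    have e : T * (T⁻¹ * g * T) * T⁻¹ = g := by group
    rw [e] at this
    exact this
  · intro y β hβ
    by_cases h : Joined x0 y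
    · simp only [F, dif_pos h]
      refine (QuotientGroup.eq_one_iff _).2 ?_
      have := hβ (τ y h)
      rwa [loopClass_eq] at this
    · simp only [F, dif_neg h]

end Con

section Fin
open CategoryTheory
variable {X : Type*} [TopologicalSpace X] {G : Type*} [Group G]

/-- restriction of a map into a set to a path in the subtype. -/
def lift (U : Set X) (p : C(I, X)) (h : ∀ t, p t ∈ U) :
    Path (⟨p 0, h 0⟩ : U) (⟨p 1, h 1⟩ : U) :=
  ⟨⟨fun t => ⟨p t, h t⟩, by fun_prop⟩, rfl, rfl⟩

open Classical in
noncomputable def phi (U : Set X) (F : ∀ {a b : U}, Path a b → G) (p : C(I, X)) : G :=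
  if h : ∀ t, p t ∈ U then F (lift U p h) else 1

lemma F_congr {Y : Type*} [TopologicalSpace Y] (F : ∀ {a b : Y}, Path a b → G) {a b a' b' : Y}
    (p : Path a b) (q : Path a' b') (h : ∀ t, p t = q t) : F p = F q := by
  have ha : a = a' := by simpa using h 0
  have hb : b = b' := by simpa using h 1
  subst ha hb
  congr 1
  ext t; exact h t

lemma coc_phi (U V : Set X) (F : ∀ {a b : U}, Path a b → G)
    (F1 : ∀ {a b : U} {p q : Path a b}, p.Homotopic q → F p = F q)
    (F2 : ∀ {a b c : U} (p : Path a b) (q : Path b c), F (p.trans q) = F q * F p)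
    (F3 : ∀ {a b : U} (p : Path a b), (∀ t, (p t : X) ∈ V) → F p = 1) :
    Coc (phi U F) U V := by
  intro f K hK hfK a ha b hb d hd
  have smem : ∀ u ∈ K, ∀ v ∈ K, ∀ t : I, u + (t : ℝ) • (v - u) ∈ K := fun u hu v hv t =>
    hK.add_smul_sub_mem hu hv t.2
  rcases hfK with h | h
  · have m : ∀ u ∈ K, ∀ v ∈ K, ∀ t, seg f u v t ∈ U := fun u hu v hv t => h _ (smem u hu v hv t)
    have e : ∀ u (hu : u ∈ K) v (hv : v ∈ K), phi U F (seg f u v) = F (lift U _ (m u hu v hv)) :=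
      fun u hu v hv => dif_pos _
    rw [e a ha d hd, e b hb d hd, e a ha b hb]
    have : ContractibleSpace K := hK.contractibleSpace ⟨a, ha⟩
    let g : C(K, U) := ⟨fun z => ⟨f z, h z z.2⟩, by fun_prop⟩
    let s : ∀ u v : K, Path u v := fun u v =>
      ⟨⟨fun t => ⟨(u : ℝ × ℝ) + (t : ℝ) • ((v : ℝ × ℝ) - u), smem u u.2 v v.2 t⟩, by fun_prop⟩,
        by simp, by simp⟩
    have e2 : ∀ u (hu : u ∈ K) v (hv : v ∈ K), F (lift U _ (m u hu v hv)) =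
        F ((s ⟨u, hu⟩ ⟨v, hv⟩).map g.continuous) := fun u hu v hv =>
      F_congr F _ _ fun t => rfl
    rw [e2 a ha d hd, e2 b hb d hd, e2 a ha b hb, ← F2, ← Path.map_trans]
    exact F1 ((SimplyConnectedSpace.paths_homotopic _ _).map g)
  · have e : ∀ u (hu : u ∈ K) v (hv : v ∈ K), phi U F (seg f u v) = 1 := by
      intro u hu v hv
      unfold phi
      split_ifs with h'
      · exact F3 _ fun t => h _ (smem u hu v hv t)
      · rfl
    rw [e a ha d hd, e b hb d hd, e a ha b hb, mul_one]

lemma exists_hom (U V : Set X) (hU : IsOpen U) (hV : IsOpen V) (hUV : ∀ x, x ∈ U ∨ x ∈ V)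
    (F : ∀ {a b : U}, Path a b → G)
    (F1 : ∀ {a b : U} {p q : Path a b}, p.Homotopic q → F p = F q)
    (F2 : ∀ {a b c : U} (p : Path a b) (q : Path b c), F (p.trans q) = F q * F p)
    (F3 : ∀ {a b : U} (p : Path a b), (∀ t, (p t : X) ∈ V) → F p = 1) (x : X) :
    ∃ Ψ : FundamentalGroup X x →* G,
      (∀ (y : X) (α : Path x y) (β : Path y y), (∀ t, β t ∈ V) → Ψ (loopClass α β) = 1) ∧
      (∀ (y : X) (α : Path x y) (β : Path y y) (h : ∀ t, β t ∈ U),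
        F (lift U β.toContinuousMap h) = 1 → Ψ (loopClass α β) = 1) ∧
      (∀ (γ : Path x x) (h : ∀ t, γ t ∈ U), Ψ (qq γ) = F (lift U γ.toContinuousMap h)) := by
  have hc := coc_phi U V F F1 F2 F3
  let Ψ : FundamentalGroup X x →* G := MonoidHom.mk'
    (fun g => Quotient.lift (fun p : Path x x => Phi (phi U F) U V p)
      (fun p q h => Phi_homotopic hc hU hV hUV h) g) (by
      intro g g'
      induction g using Path.Homotopic.Quotient.ind with | _ p
      induction g' using Path.Homotopic.Quotient.ind with | _ q
      exact Phi_trans hc hU hV hUV q p)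
  have hΨ : ∀ p : Path x x, Ψ (qq p) = Phi (phi U F) U V p := fun p => rfl
  have hl : ∀ (y : X) (α : Path x y) (β : Path y y), Phi (phi U F) U V β = 1 →
      Ψ (loopClass α β) = 1 := by
    intro y α β h
    change Phi (phi U F) U V ((α.trans β).trans α.symm) = 1
    rw [Phi_trans hc hU hV hUV, Phi_trans hc hU hV hUV, h, one_mul,
      ← Phi_trans hc hU hV hUV, ← Phi_refl hc hUV x]
    exact Phi_homotopic hc hU hV hUV (Path.Homotopic.symm ⟨Path.Homotopy.reflTransSymm α⟩)
  refine ⟨Ψ, ?_, ?_, ?_⟩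
  · intro y α β h
    apply hl
    rw [Phi_of_mem hc hUV β (Or.inr h)]
    unfold phi
    split_ifs with h'
    · exact F3 _ h
    · rfl
  · intro y α β h h1
    apply hl
    rw [Phi_of_mem hc hUV β (Or.inl h), ← h1]
    exact dif_pos _
  · intro γ h
    rw [hΨ, Phi_of_mem hc hUV γ (Or.inl h)]
    exact dif_pos _

end Fin

lemma inj {X : Type*} [MetricSpace X] (x : X) (δ R r : ℝ) (hδ : 0 < δ) (hR : 0 < R)
    (hr : R + 2 * δ < r) (hx : x ∈ Metric.ball x r)
    (γ : Path (⟨x, hx⟩ : Metric.ball x r) ⟨x, hx⟩)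
    (hγ : (qq (γ.map continuous_subtype_val) : FundamentalGroup X x) ∈ cutCoveringGroup X x δ R) :
    (qq γ : FundamentalGroup (Metric.ball x r) ⟨x, hx⟩) ∈
      cutCoveringGroup (Metric.ball x r) ⟨x, hx⟩ δ R := by
  obtain ⟨F, F1, F2, F3, F4, F5⟩ := exists_F (⟨x, hx⟩ : Metric.ball x r)
    {y | (y : X) ∈ (Metric.closedBall x R)ᶜ} (cutCoveringGroup (Metric.ball x r) ⟨x, hx⟩ δ R)
    (fun y β α h => Subgroup.subset_normalClosure ⟨y, β, α, Or.inr fun t => h t, rfl⟩)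
  obtain ⟨Ψ, h1, h2, h3⟩ := exists_hom (Metric.ball x r) (Metric.closedBall x R)ᶜ
    Metric.isOpen_ball Metric.isClosed_closedBall.isOpen_compl (by
      intro y
      by_cases h : y ∈ Metric.closedBall x R
      · exact Or.inl (Metric.closedBall_subset_ball (by linarith) h)
      · exact Or.inr h) F F1 F2 F3 x
  have hker : cutCoveringGroup X x δ R ≤ Ψ.ker := by
    apply Subgroup.normalClosure_le_normal
    rintro _ ⟨y, β, α, h, rfl⟩
    by_cases hV : ∀ t, β t ∈ (Metric.closedBall x R)ᶜ
    · exact h1 y α β hV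
    rcases h with ⟨c, hc⟩ | h
    · push Not at hV
      obtain ⟨t0, ht0⟩ := hV
      have ht0 : dist (β t0) x ≤ R := by simpa using ht0
      have hcx : dist c x < R + δ := by
        have := Metric.mem_ball.1 (hc t0)
        have := dist_triangle_left c x (β t0)
        linarith
      have hU : ∀ t, β t ∈ Metric.ball x r := by
        intro t
        have := Metric.mem_ball.1 (hc t)
        have := dist_triangle (β t) c x
        rw [Metric.mem_ball]; linarith
      refine h2 y α β hU ?_
      have e : F (lift _ β.toContinuousMap hU) =
          F ((lift _ β.toContinuousMap hU).cast (x' := ⟨y, by simpa using hU 0⟩)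
            (y' := ⟨y, by simpa using hU 0⟩) (by simp) (by simp)) :=
        F_congr F _ _ fun t => rfl
      rw [e]
      refine F5 _ fun α' => Subgroup.subset_normalClosure ⟨_, _, α', Or.inl ?_, rfl⟩
      exact ⟨⟨c, by rw [Metric.mem_ball]; linarith⟩, fun t => hc t⟩
    · exact absurd h hV
  have := hker hγ
  rw [MonoidHom.mem_ker, h3 _ (fun t => (γ t).2)] at this
  refine F4 γ (Eq.trans ?_ this)
  exact F_congr F _ _ fun t => rfl

end CutAux

/-- If `δ` is in the `R` cut-off covering spectrum of the ball
`B(x,r)` (restricted metric) with `r > 3(R + 2δ)`, then `δ` is in the `R` cut-off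
covering spectrum of `X`. -/
theorem mem_cutCovSpec_of_mem_ball_cutCovSpec
    {X : Type*} [MetricSpace X] [PathConnectedSpace X] (x : X)
    (δ R r : ℝ) (hδ : 0 < δ) (hR : 0 < R) (hr : 3 * (R + 2 * δ) < r)
    (h : δ ∈ cutCovSpec (Metric.ball x r)
      ⟨x, Metric.mem_ball_self (by linarith)⟩ R) :
    δ ∈ cutCovSpec X x R := by
  refine ⟨hδ, fun δ' hδ' heq => h.2 δ' hδ' ?_⟩
  have hx : x ∈ Metric.ball x r := Metric.mem_ball_self (by linarith)
  apply le_antisymm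
  · intro g hg
    induction g using Path.Homotopic.Quotient.ind with | _ γ
    refine CutAux.inj x δ R r hδ hR (by linarith) hx γ ?_
    rw [← heq]
    let ι : C(Metric.ball x r, X) := ⟨Subtype.val, continuous_subtype_val⟩
    let m : FundamentalGroup (Metric.ball x r) ⟨x, hx⟩ →* FundamentalGroup X x :=
      FundamentalGroup.map ι ⟨x, hx⟩
    have hle : cutCoveringGroup (Metric.ball x r) ⟨x, hx⟩ δ' R ≤
        (cutCoveringGroup X x δ' R).comap m := by
      apply Subgroup.normalClosure_le_normal
      rintro _ ⟨y, β, α, hβ, rfl⟩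
      refine Subgroup.subset_normalClosure ⟨(y : X), β.map continuous_subtype_val,
        α.map continuous_subtype_val, ?_, ?_⟩
      · rcases hβ with ⟨c, hc⟩ | hβ
        · exact Or.inl ⟨c, fun t => hc t⟩
        · exact Or.inr fun t => hβ t
      · change CutAux.qq (((α.trans β).trans α.symm).map continuous_subtype_val) =
          CutAux.qq (((α.map continuous_subtype_val).trans (β.map continuous_subtype_val)).trans
            (α.map continuous_subtype_val).symm)
        rw [Path.map_trans, Path.map_trans, Path.map_symm]
    exact hle hg
  · apply Subgroup.normalClosure_mono
    rintro _ ⟨y, β, α, hβ, rfl⟩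
    refine ⟨y, β, α, ?_, rfl⟩
    rcases hβ with ⟨c, hc⟩ | hβ
    · exact Or.inl ⟨c, fun t => Metric.ball_subset_ball hδ'.le (hc t)⟩
    · exact Or.inr hβ
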